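/- Low-Mach-number limit for the non-isentropic two-phase two-velocity system with PDE pressure closure and interface velocity u_I = u₊ (order-by-order form of Proposition 4.3). Let d ≥ 1 and γ₊, γ₋ > 1. Let α₊⁰, α₋⁰, α₊¹, α₋¹, ρ₊⁰, ρ₋⁰, ρ₊¹, ρ₋¹, S₊⁰, S₋⁰, S₊¹, S₋¹, p_int⁰ : ℝ × ℝ^d → ℝ and u₊⁰, u₋⁰ : ℝ × ℝ^d → ℝ^d be smooth ℤ^d-periodic functions with ρ₊⁰ > 0, ρ₋⁰ > 0, 0 < α₊⁰ < 1 everywhere, and set p±⁰ := (ρ±⁰)^{γ±}e^{S±⁰} and π±¹ := p±⁰(γ± ρ±¹/ρ±⁰ + S±¹). Assume: (i) α₊⁰ + α₋⁰ = 1; (ii) α₊⁰α₋⁰(p₊⁰ − p₋⁰) = 0; (iii) α±⁰∇p±⁰ = 0 for both phases; (iv) ∂ₜ(α±⁰ρ±⁰) + div(α±⁰ρ±⁰u±⁰) = 0 for both phases; (v) ∂ₜS±⁰ + u±⁰·∇S±⁰ = 0 for both phases; (vi) ∂ₜα₊⁰ + u₊⁰·∇α₊⁰ = α₊⁰α₋⁰(π₊¹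 − π₋¹); (vii) for each phase, ∂ₜ(α±⁰ρ±⁰u±⁰) + div(α±⁰ρ±⁰u±⁰⊗u±⁰) + α±⁰∇π±¹ + α±¹∇p±⁰ + p_int⁰∇α±⁰ = 0. Then: there is a constant C > 0 (in space and time) with p₊⁰ = p₋⁰ = C, hence ρ±⁰ = C^{1/γ±}e^{−S±⁰/γ±}; div(α₊⁰u₊⁰ + α₋⁰u₋⁰) = 0; ∂ₜα₊⁰ + div(α₊⁰u₊⁰) = 0; the constraint −α₊⁰ div u₊⁰ = α₊⁰α₋⁰(π₊¹ − π₋¹) holds (equivalently α₊⁰ div u₊⁰ = α₊⁰α₋⁰(π₋¹ − π₊¹)); and the limit momentum equations ∂ₜ(α±⁰ρ±⁰u±⁰) + div(α±⁰ρ±⁰u±⁰⊗u±⁰) + α±⁰∇π±¹ + p_int⁰∇α±⁰ = 0 hold for both phases. -/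

import Mathlib

open MeasureTheory Real

noncomputable section

/-- A space–time point: time in `ℝ`, space in `ℝ^d`. -/
abbrev Pt (d : ℕ) := ℝ × (Fin d → ℝ)

/-- Time derivative `∂ₜ f`. -/
def pt {d : ℕ} (f : Pt d → ℝ) (p : Pt d) : ℝ :=
  fderiv ℝ f p (1, 0)

/-- Spatial partial derivative `∂_{x i} f`. -/
def pd {d : ℕ} (i : Fin d) (f : Pt d → ℝ) (p : Pt d) : ℝ :=
  fderiv ℝ f p (0, Pi.single i 1)

/-- Spatial divergence of a vector field. -/
def divg {d : ℕ} (u : Pt d → Fin d → ℝ) (p : Pt d) : ℝ :=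
  ∑ i, pd i (fun q => u q i) p

/-- Spatial Laplacian of a scalar function. -/
def lap {d : ℕ} (f : Pt d → ℝ) (p : Pt d) : ℝ :=
  ∑ i, pd i (fun q => pd i f q) p

/-- `i`-th component of `div (r u ⊗ u)`, i.e. `∑ j ∂_{x j} (r u_i u_j)`. -/
def divT {d : ℕ} (r : Pt d → ℝ) (u : Pt d → Fin d → ℝ) (p : Pt d) (i : Fin d) : ℝ :=
  ∑ j, pd j (fun q => r q * u q i * u q j) p

/-- Symmetric gradient `D(u) = (∇u + (∇u)ᵀ)/2`. -/
def Dsym {d : ℕ} (u : Pt d → Fin d → ℝ) (p : Pt d) (i j : Fin d) : ℝ :=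
  (pd j (fun q => u q i) p + pd i (fun q => u q j) p) / 2

/-- Divergence of a matrix field, `i`-th component `∑ j ∂_{x j} M_{ij}`. -/
def divM {d : ℕ} (M : Pt d → Fin d → Fin d → ℝ) (p : Pt d) (i : Fin d) : ℝ :=
  ∑ j, pd j (fun q => M q i j) p

/-- `ℤ^d`-periodicity in the space variable. -/
def ZPeriodic {d : ℕ} (f : Pt d → ℝ) : Prop :=
  ∀ (k : Fin d → ℤ) (t : ℝ) (x : Fin d → ℝ), f (t, x + fun i => (k i : ℝ)) = f (t, x)

/-- `ℤ^d`-periodicity of a vector field. -/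
def ZPeriodicVec {d : ℕ} (u : Pt d → Fin d → ℝ) : Prop :=
  ∀ i, ZPeriodic (fun q => u q i)

/-- The unit cell `[0,1]^d`. -/
def cell (d : ℕ) : Set (Fin d → ℝ) := Set.Icc 0 1

theorem pt_mul {d : ℕ} {f g : Pt d → ℝ} {p : Pt d} (hf : DifferentiableAt ℝ f p)
    (hg : DifferentiableAt ℝ g p) :
    pt (fun q => f q * g q) p = f p * pt g p + g p * pt f p := by
  simp [pt, fderiv_fun_mul hf hg]

theorem pd_mul {d : ℕ} {f g : Pt d → ℝ} {p : Pt d} (i : Fin d) (hf : DifferentiableAt ℝ f p)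
    (hg : DifferentiableAt ℝ g p) :
    pd i (fun q => f q * g q) p = f p * pd i g p + g p * pd i f p := by
  simp [pd, fderiv_fun_mul hf hg]

theorem divg_mul {d : ℕ} {f : Pt d → ℝ} {u : Pt d → Fin d → ℝ} {p : Pt d}
    (hf : DifferentiableAt ℝ f p) (hu : ∀ i, DifferentiableAt ℝ (fun q => u q i) p) :
    divg (fun q j => f q * u q j) p = f p * divg u p + ∑ i, u p i * pd i f p := by
  simp only [divg, pd_mul _ hf (hu _), Finset.sum_add_distrib, Finset.mul_sum]

theorem divg_add {d : ℕ} {u v : Pt d → Fin d → ℝ} {p : Pt d}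
    (hu : ∀ i, DifferentiableAt ℝ (fun q => u q i) p)
    (hv : ∀ i, DifferentiableAt ℝ (fun q => v q i) p) :
    divg (fun q j => u q j + v q j) p = divg u p + divg v p := by
  simp [divg, pd, fderiv_fun_add (hu _) (hv _), Finset.sum_add_distrib]

theorem fderiv_rpow_mul_exp {d : ℕ} {γ : ℝ} {ρ S : Pt d → ℝ} {p : Pt d}
    (hρ : DifferentiableAt ℝ ρ p) (hS : DifferentiableAt ℝ S p) (hpos : 0 < ρ p) (v : Pt d) :
    ρ p * fderiv ℝ (fun q => ρ q ^ γ * Real.exp (S q)) p v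
      = ρ p ^ γ * Real.exp (S p) * (γ * fderiv ℝ ρ p v + ρ p * fderiv ℝ S p v) := by
  have h := (hρ.hasFDerivAt.rpow_const (p := γ) (Or.inl hpos.ne')).fun_mul hS.hasFDerivAt.exp
  rw [h.fderiv]
  simp only [add_apply, smul_apply, smul_eq_mul, Real.rpow_sub_one hpos.ne']
  field_simp
  ring

/-- Mass conservation, entropy transport and a spatially constant pressure determine the defect
of the transport equation for the volume fraction of one phase. -/
theorem volumeFraction_defect {d : ℕ} {γ : ℝ} {α ρ S : Pt d → ℝ} {u : Pt d → Fin d → ℝ} {p : Pt d}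
    (hα : DifferentiableAt ℝ α p) (hρ : DifferentiableAt ℝ ρ p) (hS : DifferentiableAt ℝ S p)
    (hu : ∀ i, DifferentiableAt ℝ (fun q => u q i) p) (hpos : 0 < ρ p)
    (hgrad : ∀ i, pd i (fun q => ρ q ^ γ * Real.exp (S q)) p = 0)
    (hmass : pt (fun q => α q * ρ q) p + divg (fun q j => α q * ρ q * u q j) p = 0)
    (hent : pt S p + ∑ i, u p i * pd i S p = 0) :
    ρ p ^ γ * Real.exp (S p) * γ * (pt α p + divg (fun q j => α q * u q j) p)
      = -(α p * pt (fun q => ρ q ^ γ * Real.exp (S q)) p) := by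
  have hP : 0 < ρ p ^ γ * Real.exp (S p) := by positivity
  have hpdρ (i : Fin d) : γ * pd i ρ p = -(ρ p * pd i S p) := by
    have h := fderiv_rpow_mul_exp (γ := γ) hρ hS hpos (0, Pi.single i 1)
    have h0 := hgrad i
    simp only [pd] at h0 ⊢
    rw [h0, mul_zero, eq_comm, mul_eq_zero] at h
    linarith [h.resolve_left hP.ne']
  have hsum : γ * ∑ i, u p i * pd i ρ p = ρ p * pt S p := by
    have h : γ * ∑ i, u p i * pd i ρ p = -(ρ p * ∑ i, u p i * pd i S p) := by
      rw [Finset.mul_sum, Finset.mul_sum, ← Finset.sum_neg_distrib]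
      exact Finset.sum_congr rfl fun i _ => by linear_combination u p i * hpdρ i
    linear_combination h - ρ p * hent
  have hpt : ρ p * pt (fun q => ρ q ^ γ * Real.exp (S q)) p
      = ρ p ^ γ * Real.exp (S p) * (γ * pt ρ p + ρ p * pt S p) :=
    fderiv_rpow_mul_exp hρ hS hpos (1, 0)
  have hdiv : divg (fun q j => α q * ρ q * u q j) p
      = ρ p * divg (fun q j => α q * u q j) p + ∑ i, α p * u p i * pd i ρ p := by
    rw [← divg_mul hρ fun i => hα.fun_mul (hu i)]
    congr 1
    funext q j
    ring
  have hfac : ∑ i, α p * u p i * pd i ρ p = α p * ∑ i, u p i * pd i ρ p := by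
    simp only [Finset.mul_sum, mul_assoc]
  rw [pt_mul hα hρ, hdiv, hfac] at hmass
  apply mul_left_cancel₀ hpos.ne'
  linear_combination ρ p ^ γ * Real.exp (S p) * γ * hmass + α p * hpt
    - ρ p ^ γ * Real.exp (S p) * α p * hsum

theorem continuous_divg {d : ℕ} {u : Pt d → Fin d → ℝ}
    (hu : ∀ i, ContDiff ℝ 1 fun q => u q i) : Continuous (divg u) :=
  continuous_finsetSum _ fun i _ => ((hu i).continuous_fderiv one_ne_zero).clm_apply continuous_const

/-- The divergence of a periodic field has zero integral over the unit cell. -/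
theorem integral_divg_eq_zero {d : ℕ} {u : Pt d → Fin d → ℝ}
    (hu : ∀ i, ContDiff ℝ 1 fun q => u q i) (hper : ZPeriodicVec u) (t : ℝ) :
    ∫ x in cell d, divg u (t, x) = 0 := by
  cases d with
  | zero => simp [divg]
  | succ n =>
    have hdiff (i : Fin (n + 1)) (x : Fin (n + 1) → ℝ) :
        HasFDerivAt (fun y => u (t, y) i)
          ((fderiv ℝ (fun q => u q i) (t, x)).comp (ContinuousLinearMap.inr ℝ ℝ _)) x :=
      (((hu i).differentiable one_ne_zero) (t, x)).hasFDerivAt.comp x (hasFDerivAt_prodMk_right t x)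
    have hcont : Continuous fun x => divg u (t, x) := (continuous_divg hu).comp (by fun_prop)
    have h := integral_divergence_of_hasFDerivAt_off_countable' (0 : Fin (n + 1) → ℝ) 1 zero_le_one
      (fun i y => u (t, y) i) _ ∅ Set.countable_empty
      (fun i => (continuous_iff_continuousAt.2 fun x => (hdiff i x).continuousAt).continuousOn)
      (fun x _ i => hdiff i x) (hcont.continuousOn.integrableOn_compact isCompact_Icc)
    refine h.trans (Finset.sum_eq_zero fun i _ => sub_eq_zero.2 ?_)
    congr 1
    funext y
    have hshift : i.insertNth (1 : ℝ) y
        = i.insertNth (0 : ℝ) y + fun j => ((Pi.single i 1 : Fin (n + 1) → ℤ) j : ℝ) := by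
      funext j
      refine i.succAboveCases ?_ (fun k => ?_) j <;> simp
    simpa [hshift] using hper i (Pi.single i 1) t (i.insertNth (0 : ℝ) y)

/-- The divergence of a periodic field cannot have a strict sign at a fixed time. -/
theorem exists_divg_nonneg_and_exists_divg_nonpos {d : ℕ} {u : Pt d → Fin d → ℝ}
    (hu : ∀ i, ContDiff ℝ 1 fun q => u q i) (hper : ZPeriodicVec u) (t : ℝ) :
    (∃ x, 0 ≤ divg u (t, x)) ∧ ∃ x, divg u (t, x) ≤ 0 := by
  have hcont : Continuous fun x => divg u (t, x) := (continuous_divg hu).comp (by fun_prop)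
  have hint : IntegrableOn (fun x => divg u (t, x)) (cell d) :=
    hcont.continuousOn.integrableOn_compact isCompact_Icc
  have havg : ⨍ x in cell d, divg u (t, x) = 0 := by
    rw [setAverage_eq, integral_divg_eq_zero hu hper, smul_zero]
  have hvol : volume (cell d) = 1 := by simp [cell, Real.volume_Icc_pi]
  have h0 : volume (cell d) ≠ 0 := by simp [hvol]
  have h1 : volume (cell d) ≠ ⊤ := by simp [hvol]
  obtain ⟨x, -, hx⟩ := exists_setAverage_le h0 h1 hint
  obtain ⟨y, -, hy⟩ := exists_le_setAverage h0 h1 hint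
  exact ⟨⟨x, havg ▸ hx⟩, y, havg ▸ hy⟩

theorem eq_apply_fst_zero_of_pd_eq_zero {d : ℕ} {f : Pt d → ℝ} (hf : Differentiable ℝ f)
    (h : ∀ p i, pd i f p = 0) (p : Pt d) : f p = f (p.1, 0) := by
  obtain ⟨t, x⟩ := p
  have hd (y : Fin d → ℝ) : HasFDerivAt (fun z => f (t, z))
      ((fderiv ℝ f (t, y)).comp (ContinuousLinearMap.inr ℝ ℝ _)) y :=
    (hf (t, y)).hasFDerivAt.comp y (hasFDerivAt_prodMk_right t y)
  refine is_const_of_fderiv_eq_zero (𝕜 := ℝ) (f := fun z => f (t, z))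
    (fun y => (hd y).differentiableAt) (fun y => ?_) x 0
  rw [(hd y).fderiv]
  refine ContinuousLinearMap.coe_injective (LinearMap.pi_ext' fun i => LinearMap.ext_ring ?_)
  simpa [pd] using h (t, y) i

theorem pt_eq_deriv_of_pd_eq_zero {d : ℕ} {f : Pt d → ℝ} (hf : Differentiable ℝ f)
    (h : ∀ p i, pd i f p = 0) (p : Pt d) : pt f p = deriv (fun t => f (t, 0)) p.1 := by
  have hg : HasDerivAt (fun t => f (t, 0)) (deriv (fun t => f (t, 0)) p.1) p.1 :=
    DifferentiableAt.hasDerivAt (by fun_prop)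
  have hfg : f = (fun t => f (t, 0)) ∘ Prod.fst := funext (eq_apply_fst_zero_of_pd_eq_zero hf h)
  have hc := (hg.hasFDerivAt.comp p hasFDerivAt_fst).congr_of_eventuallyEq
    (Filter.EventuallyEq.of_eq hfg)
  simp [pt, hc.fderiv]

theorem eq_rpow_mul_exp_of_rpow_mul_exp_eq {γ r s C : ℝ} (hγ : γ ≠ 0) (hr : 0 < r)
    (h : r ^ γ * Real.exp s = C) : r = C ^ (1 / γ) * Real.exp (-s / γ) := by
  rw [← h, Real.mul_rpow (by positivity) (by positivity), ← Real.rpow_mul hr.le,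
    mul_one_div_cancel hγ, Real.rpow_one, ← Real.exp_mul, mul_assoc, ← Real.exp_add]
  ring_nf
  simp

/-- low-Mach-number limit for the non-isentropic two-phase two-velocity
system with PDE pressure closure and interface velocity `u_I = u₊`
(order-by-order form of Proposition 4.3). Here `p±⁰ = (ρ±⁰)^{γ±} e^{S±⁰}` and
`π±¹ = p±⁰ (γ± ρ±¹/ρ±⁰ + S±¹)` are written out explicitly. -/
theorem lowMach_twoPhase_twoVelocity_nonisentropic_PDEclosure
    {d : ℕ} (hd : 1 ≤ d) (γp γm : ℝ) (hγp : 1 < γp) (hγm : 1 < γm)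
    (αp0 αm0 αp1 αm1 ρp0 ρm0 ρp1 ρm1 Sp0 Sm0 Sp1 Sm1 pint0 : Pt d → ℝ)
    (up0 um0 : Pt d → Fin d → ℝ)
    (hreg : ContDiff ℝ (⊤ : ℕ∞) αp0 ∧ ContDiff ℝ (⊤ : ℕ∞) αm0 ∧ ContDiff ℝ (⊤ : ℕ∞) αp1 ∧ ContDiff ℝ (⊤ : ℕ∞) αm1 ∧
      ContDiff ℝ (⊤ : ℕ∞) ρp0 ∧ ContDiff ℝ (⊤ : ℕ∞) ρm0 ∧ ContDiff ℝ (⊤ : ℕ∞) ρp1 ∧ ContDiff ℝ (⊤ : ℕ∞) ρm1 ∧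
      ContDiff ℝ (⊤ : ℕ∞) Sp0 ∧ ContDiff ℝ (⊤ : ℕ∞) Sm0 ∧ ContDiff ℝ (⊤ : ℕ∞) Sp1 ∧ ContDiff ℝ (⊤ : ℕ∞) Sm1 ∧
      ContDiff ℝ (⊤ : ℕ∞) pint0 ∧ ContDiff ℝ (⊤ : ℕ∞) up0 ∧ ContDiff ℝ (⊤ : ℕ∞) um0)
    (hper : ZPeriodic αp0 ∧ ZPeriodic αm0 ∧ ZPeriodic αp1 ∧ ZPeriodic αm1 ∧
      ZPeriodic ρp0 ∧ ZPeriodic ρm0 ∧ ZPeriodic ρp1 ∧ ZPeriodic ρm1 ∧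
      ZPeriodic Sp0 ∧ ZPeriodic Sm0 ∧ ZPeriodic Sp1 ∧ ZPeriodic Sm1 ∧
      ZPeriodic pint0 ∧ ZPeriodicVec up0 ∧ ZPeriodicVec um0)
    (hρp : ∀ p, 0 < ρp0 p) (hρm : ∀ p, 0 < ρm0 p)
    (hαpos : ∀ p, 0 < αp0 p ∧ αp0 p < 1)
    -- (i)
    (hα0 : ∀ p, αp0 p + αm0 p = 1)
    -- (ii)
    (hpeq0 : ∀ p, αp0 p * αm0 p
      * (ρp0 p ^ γp * Real.exp (Sp0 p) - ρm0 p ^ γm * Real.exp (Sm0 p)) = 0)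
    -- (iii)
    (hgradp : ∀ p (i : Fin d),
      αp0 p * pd i (fun q => ρp0 q ^ γp * Real.exp (Sp0 q)) p = 0)
    (hgradm : ∀ p (i : Fin d),
      αm0 p * pd i (fun q => ρm0 q ^ γm * Real.exp (Sm0 q)) p = 0)
    -- (iv)
    (hmassp : ∀ p, pt (fun q => αp0 q * ρp0 q) p
      + divg (fun q j => αp0 q * ρp0 q * up0 q j) p = 0)
    (hmassm : ∀ p, pt (fun q => αm0 q * ρm0 q) p
      + divg (fun q j => αm0 q * ρm0 q * um0 q j) p = 0)
    -- (v)
    (hentp : ∀ p : Pt d, pt Sp0 p + ∑ i, up0 p i * pd i Sp0 p = 0)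
    (hentm : ∀ p : Pt d, pt Sm0 p + ∑ i, um0 p i * pd i Sm0 p = 0)
    -- (vi)
    (hclosure : ∀ p : Pt d, pt αp0 p + ∑ i, up0 p i * pd i αp0 p
      = αp0 p * αm0 p
        * (ρp0 p ^ γp * Real.exp (Sp0 p) * (γp * ρp1 p / ρp0 p + Sp1 p)
          - ρm0 p ^ γm * Real.exp (Sm0 p) * (γm * ρm1 p / ρm0 p + Sm1 p)))
    -- (vii)
    (hmomp : ∀ p (i : Fin d),
      pt (fun q => αp0 q * ρp0 q * up0 q i) p
      + divT (fun q => αp0 q * ρp0 q) up0 p i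
      + αp0 p * pd i (fun q =>
          ρp0 q ^ γp * Real.exp (Sp0 q) * (γp * ρp1 q / ρp0 q + Sp1 q)) p
      + αp1 p * pd i (fun q => ρp0 q ^ γp * Real.exp (Sp0 q)) p
      + pint0 p * pd i αp0 p = 0)
    (hmomm : ∀ p (i : Fin d),
      pt (fun q => αm0 q * ρm0 q * um0 q i) p
      + divT (fun q => αm0 q * ρm0 q) um0 p i
      + αm0 p * pd i (fun q =>
          ρm0 q ^ γm * Real.exp (Sm0 q) * (γm * ρm1 q / ρm0 q + Sm1 q)) p
      + αm1 p * pd i (fun q => ρm0 q ^ γm * Real.exp (Sm0 q)) p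
      + pint0 p * pd i αm0 p = 0) :
    -- conclusions
    (∃ C : ℝ, 0 < C ∧
      (∀ p : Pt d, ρp0 p ^ γp * Real.exp (Sp0 p) = C) ∧
      (∀ p : Pt d, ρm0 p ^ γm * Real.exp (Sm0 p) = C) ∧
      (∀ p : Pt d, ρp0 p = C ^ (1 / γp) * Real.exp (-Sp0 p / γp)) ∧
      (∀ p : Pt d, ρm0 p = C ^ (1 / γm) * Real.exp (-Sm0 p / γm))) ∧
    (∀ p : Pt d, divg (fun q j => αp0 q * up0 q j + αm0 q * um0 q j) p = 0) ∧
    (∀ p : Pt d, pt αp0 p + divg (fun q j => αp0 q * up0 q j) p = 0) ∧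
    (∀ p : Pt d, -(αp0 p * divg up0 p)
      = αp0 p * αm0 p
        * (ρp0 p ^ γp * Real.exp (Sp0 p) * (γp * ρp1 p / ρp0 p + Sp1 p)
          - ρm0 p ^ γm * Real.exp (Sm0 p) * (γm * ρm1 p / ρm0 p + Sm1 p))) ∧
    (∀ p (i : Fin d),
      pt (fun q => αp0 q * ρp0 q * up0 q i) p
      + divT (fun q => αp0 q * ρp0 q) up0 p i
      + αp0 p * pd i (fun q =>
          ρp0 q ^ γp * Real.exp (Sp0 q) * (γp * ρp1 q / ρp0 q + Sp1 q)) p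
      + pint0 p * pd i αp0 p = 0) ∧
    (∀ p (i : Fin d),
      pt (fun q => αm0 q * ρm0 q * um0 q i) p
      + divT (fun q => αm0 q * ρm0 q) um0 p i
      + αm0 p * pd i (fun q =>
          ρm0 q ^ γm * Real.exp (Sm0 q) * (γm * ρm1 q / ρm0 q + Sm1 q)) p
      + pint0 p * pd i αm0 p = 0) := by
  obtain ⟨cαp, cαm, -, -, cρp, cρm, -, -, cSp, cSm, -, -, -, cup, cum⟩ := hreg
  obtain ⟨pαp, pαm, -, -, -, -, -, -, -, -, -, -, -, pup, pum⟩ := hper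
  have hαp (p) : 0 < αp0 p := (hαpos p).1
  have hαm (p) : 0 < αm0 p := by linarith [hα0 p, (hαpos p).2]
  have cupi (i) : ContDiff ℝ (⊤ : ℕ∞) fun q => up0 q i := contDiff_pi.1 cup i
  have cumi (i) : ContDiff ℝ (⊤ : ℕ∞) fun q => um0 q i := contDiff_pi.1 cum i
  have dαp : Differentiable ℝ αp0 := cαp.differentiable (by simp)
  have dαm : Differentiable ℝ αm0 := cαm.differentiable (by simp)
  have dρp : Differentiable ℝ ρp0 := cρp.differentiable (by simp)
  have dρm : Differentiable ℝ ρm0 := cρm.differentiable (by simp)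
  have dSp : Differentiable ℝ Sp0 := cSp.differentiable (by simp)
  have dSm : Differentiable ℝ Sm0 := cSm.differentiable (by simp)
  have dup (i) : Differentiable ℝ fun q => up0 q i := (cupi i).differentiable (by simp)
  have dum (i) : Differentiable ℝ fun q => um0 q i := (cumi i).differentiable (by simp)
  have hgp (p) (i : Fin d) : pd i (fun q => ρp0 q ^ γp * Real.exp (Sp0 q)) p = 0 :=
    (mul_eq_zero.1 (hgradp p i)).resolve_left (hαp p).ne'
  have hgm (p) (i : Fin d) : pd i (fun q => ρm0 q ^ γm * Real.exp (Sm0 q)) p = 0 :=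
    (mul_eq_zero.1 (hgradm p i)).resolve_left (hαm p).ne'
  have heq : (fun q => ρm0 q ^ γm * Real.exp (Sm0 q)) = fun q => ρp0 q ^ γp * Real.exp (Sp0 q) :=
    funext fun p => (sub_eq_zero.1 ((mul_eq_zero.1 (hpeq0 p)).resolve_left
      (mul_pos (hαp p) (hαm p)).ne')).symm
  have hdefp (p) := volumeFraction_defect (dαp p) (dρp p) (dSp p) (fun i => dup i p) (hρp p)
    (hgp p) (hmassp p) (hentp p)
  have hdefm (p) := volumeFraction_defect (dαm p) (dρm p) (dSm p) (fun i => dum i p) (hρm p)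
    (hgm p) (hmassm p) (hentm p)
  have heq' (p) := congrFun heq p
  simp only [heq'] at hdefm
  have hPpos (p) : 0 < ρp0 p ^ γp * Real.exp (Sp0 p) :=
    mul_pos (Real.rpow_pos_of_pos (hρp p) _) (Real.exp_pos _)
  have dP : Differentiable ℝ fun q => ρp0 q ^ γp * Real.exp (Sp0 q) := fun p =>
    ((dρp p).rpow_const (Or.inl (hρp p).ne')).fun_mul (dSp p).exp
  have hαsum (p) : pt αp0 p + pt αm0 p = 0 := by
    have h : αm0 = fun q => 1 - αp0 q := funext fun q => by linarith [hα0 q]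
    simp [h, pt, fderiv_const_sub]
  have hdivsum (p) : divg (fun q j => αp0 q * up0 q j + αm0 q * um0 q j) p
      = divg (fun q j => αp0 q * up0 q j) p + divg (fun q j => αm0 q * um0 q j) p :=
    divg_add (fun i => (dαp p).fun_mul (dup i p)) fun i => (dαm p).fun_mul (dum i p)
  have hdiv (p) : divg (fun q j => αp0 q * up0 q j + αm0 q * um0 q j) p
      * (ρp0 p ^ γp * Real.exp (Sp0 p) * (γp * γm))
      = -((αp0 p * γm + αm0 p * γp) * pt (fun q => ρp0 q ^ γp * Real.exp (Sp0 q)) p) := by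
    linear_combination (ρp0 p ^ γp * Real.exp (Sp0 p) * (γp * γm)) * (hdivsum p - hαsum p)
      + γm * hdefp p + γp * hdefm p
  have hγ : 0 < γp * γm := by positivity
  have hw (p) : 0 < αp0 p * γm + αm0 p * γp := by
    have := hαp p
    have := hαm p
    positivity
  have hpt (p : Pt d) : pt (fun q => ρp0 q ^ γp * Real.exp (Sp0 q)) p = 0 := by
    have hconst (x) : pt (fun q => ρp0 q ^ γp * Real.exp (Sp0 q)) (p.1, x)
        = pt (fun q => ρp0 q ^ γp * Real.exp (Sp0 q)) p := by
      rw [pt_eq_deriv_of_pd_eq_zero dP hgp, pt_eq_deriv_of_pd_eq_zero dP hgp p]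
    obtain ⟨⟨x, hx⟩, y, hy⟩ := exists_divg_nonneg_and_exists_divg_nonpos
      (u := fun q j => αp0 q * up0 q j + αm0 q * um0 q j)
      (fun i => ((cαp.mul (cupi i)).add (cαm.mul (cumi i))).of_le (by simp))
      (fun i k t z => by
        have h1 := pup i k t z
        have h2 := pum i k t z
        simp only at h1 h2 ⊢
        rw [pαp k t z, pαm k t z, h1, h2]) p.1
    have ex := hdiv (p.1, x)
    have ey := hdiv (p.1, y)
    rw [hconst] at ex ey
    apply le_antisymm
    · have := mul_nonneg hx (mul_pos (hPpos (p.1, x)) hγ).le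
      exact nonpos_of_mul_nonpos_right (by linarith) (hw (p.1, x))
    · have := mul_nonpos_of_nonpos_of_nonneg hy (mul_pos (hPpos (p.1, y)) hγ).le
      exact nonneg_of_mul_nonneg_right (by linarith) (hw (p.1, y))
  have hPconst (p) : ρp0 p ^ γp * Real.exp (Sp0 p) = ρp0 0 ^ γp * Real.exp (Sp0 0) := by
    refine (eq_apply_fst_zero_of_pd_eq_zero dP hgp p).trans ?_
    exact is_const_of_deriv_eq_zero
      (f := fun t : ℝ => ρp0 (t, 0) ^ γp * Real.exp (Sp0 (t, 0)))
      (dP.comp (g := fun q => ρp0 q ^ γp * Real.exp (Sp0 q)) (f := fun t => (t, 0)) (by fun_prop))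
      (fun t => (pt_eq_deriv_of_pd_eq_zero dP hgp (t, 0)).symm.trans (hpt _)) p.1 0
  have htrans (p) : pt αp0 p + divg (fun q j => αp0 q * up0 q j) p = 0 := by
    have h := hdefp p
    rw [hpt, mul_zero, neg_zero] at h
    exact (mul_eq_zero.1 h).resolve_left (mul_pos (hPpos p) (by positivity)).ne'
  refine ⟨⟨ρp0 0 ^ γp * Real.exp (Sp0 0), hPpos 0, hPconst, fun p => (heq' p).trans (hPconst p),
    fun p => eq_rpow_mul_exp_of_rpow_mul_exp_eq (by positivity) (hρp p) (hPconst p),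
    fun p => eq_rpow_mul_exp_of_rpow_mul_exp_eq (by positivity) (hρm p)
      ((heq' p).trans (hPconst p))⟩, fun p => ?_, htrans, fun p => ?_, fun p i => ?_,
    fun p i => ?_⟩
  · have h := hdiv p
    rw [hpt, mul_zero, neg_zero] at h
    exact (mul_eq_zero.1 h).resolve_right (mul_pos (hPpos p) hγ).ne'
  · rw [← hclosure p]
    have h := htrans p
    rw [divg_mul (dαp p) fun i => dup i p] at h
    linear_combination -h
  · have h := hmomp p i
    rwa [hgp, mul_zero, add_zero] at h
  · have h := hmomm p i
    rwa [hgm, mul_zero, add_zero] at h
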